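/- For every prime p there exist constants c > 0 and C > 0 (depending only on p) such that the following holds: for every integer n with log log log n > 0, every restricted 3-AP free set A ⊆ 𝔽_p^n has density |A|/p^n ≤ C/(log log log n)^c. -/

import Mathlib

open Finset
open scoped BigOperators ComplexConjugate

section Fourier

variable {ι : Type*} [Fintype ι] {p : ℕ} [NeZero p]

/-- The additive character of `𝔽_p^ι` with frequency `r`, evaluated at `x`. -/
noncomputable def dotChar (r x : ι → ZMod p) : ℂ := ZMod.stdAddChar (r ⬝ᵥ x)

/-- The normalised Fourier transform of a real function on `𝔽_p^ι`. -/
noncomputable def dotFourier [DecidableEq ι] (F : (ι → ZMod p) → ℝ) (r : ι → ZMod p) : ℂ :=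
  𝔼 x, (F x : ℂ) * dotChar r x

lemma dotChar_add (r x y : ι → ZMod p) : dotChar r (x + y) = dotChar r x * dotChar r y := by
  simp [dotChar, dotProduct_add, AddChar.map_add_eq_mul]

lemma dotChar_zero (r : ι → ZMod p) : dotChar r 0 = 1 := by
  simp [dotChar]

lemma norm_dotChar (r x : ι → ZMod p) : ‖dotChar r x‖ = 1 :=
  AddChar.norm_apply _ _

lemma conj_dotChar (r x : ι → ZMod p) : conj (dotChar r x) = dotChar r (-x) := by
  simp [dotChar, dotProduct_neg, AddChar.map_neg_eq_conj]

lemma dotChar_eq_prod (r x : ι → ZMod p) :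
    dotChar r x = ∏ i, ZMod.stdAddChar (r i * x i) := by
  exact map_prod (ZMod.stdAddChar (N := p)).toMonoidHom
    (fun i ↦ Multiplicative.ofAdd (r i * x i)) univ

variable [DecidableEq ι]

lemma sum_dotChar (x : ι → ZMod p) :
    ∑ r, dotChar r x = if x = 0 then (Fintype.card (ι → ZMod p) : ℂ) else 0 := by
  split_ifs with h
  · simp [h, dotChar_zero]
  · obtain ⟨i, hi⟩ := Function.ne_iff.mp h
    let ψ : AddChar (ι → ZMod p) ℂ :=
      { toFun := fun r ↦ dotChar r x
        map_zero_eq_one' := by simp [dotChar]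
        map_add_eq_mul' := fun a b ↦ by simp [dotChar, add_dotProduct, AddChar.map_add_eq_mul] }
    refine AddChar.sum_eq_zero_of_ne_one (ψ := ψ) fun hψ ↦ hi ?_
    have h1 : ψ (Pi.single i 1) = 1 := by rw [hψ]; rfl
    have h2 : ZMod.stdAddChar (x i) = 1 := by
      simpa [ψ, dotChar] using h1
    exact (ZMod.injective_stdAddChar) (by simpa using h2)

/-- Parseval's identity. -/
lemma sum_norm_dotFourier_sq (F : (ι → ZMod p) → ℝ) :
    ∑ r, ‖dotFourier F r‖ ^ 2 = 𝔼 x, F x ^ 2 := by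
  have key (r : ι → ZMod p) : ((‖dotFourier F r‖ ^ 2 : ℝ) : ℂ) =
      𝔼 x, 𝔼 y, (F x * F y : ℂ) * dotChar r (x + -y) := by
    rw [← Complex.normSq_eq_norm_sq, ← Complex.mul_conj, dotFourier, map_expect, expect_mul_expect]
    refine expect_congr rfl fun x _ ↦ expect_congr rfl fun y _ ↦ ?_
    simp only [map_mul, Complex.conj_ofReal, conj_dotChar, dotChar_add]
    ring
  have : ((∑ r, ‖dotFourier F r‖ ^ 2 : ℝ) : ℂ) = ((𝔼 x, F x ^ 2 : ℝ) : ℂ) := by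
    rw [Complex.ofReal_sum]
    simp_rw [key]
    rw [← expect_sum_comm, Complex.ofReal_expect]
    refine expect_congr rfl fun x _ ↦ ?_
    rw [← expect_sum_comm]
    simp_rw [← mul_sum, sum_dotChar, ← sub_eq_add_neg, sub_eq_zero, mul_ite, mul_zero]
    rw [Fintype.expect_eq_sum_div_card]
    simp [sq]
  exact_mod_cast this

lemma dotFourier_expect_shift {κ : Type*} [Fintype κ] (v : κ → ι → ZMod p)
    (F : (ι → ZMod p) → ℝ) (r : ι → ZMod p) :
    dotFourier (fun x ↦ 𝔼 k, F (x + v k)) r = dotFourier F r * conj (𝔼 k, dotChar r (v k)) := by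
  simp only [dotFourier, Complex.ofReal_expect, expect_mul]
  rw [expect_comm, map_expect]
  simp_rw [← expect_mul]
  rw [mul_expect]
  refine expect_congr rfl fun k _ ↦ ?_
  rw [expect_mul]
  refine Fintype.expect_equiv (Equiv.addRight (v k)) _ _ fun x ↦ ?_
  rw [conj_dotChar, Equiv.coe_addRight, mul_assoc, ← dotChar_add]
  simp

/-- The mean square of an average of shifts of `F`, on the Fourier side. -/
lemma expect_expect_shift_sq {κ : Type*} [Fintype κ] (v : κ → ι → ZMod p)
    (F : (ι → ZMod p) → ℝ) :
    𝔼 x, (𝔼 k, F (x + v k)) ^ 2 = ∑ r, ‖dotFourier F r‖ ^ 2 * ‖𝔼 k, dotChar r (v k)‖ ^ 2 := by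
  rw [← sum_norm_dotFourier_sq (fun x ↦ 𝔼 k, F (x + v k))]
  simp_rw [dotFourier_expect_shift, norm_mul, RCLike.norm_conj, mul_pow]

lemma expect_prod_bool (g : ι → Bool → ℂ) :
    𝔼 c : ι → Bool, ∏ i, g i (c i) = ∏ i, 𝔼 b, g i b := by
  have h := prod_univ_sum (fun _ : ι ↦ (univ : Finset Bool)) g
  simp only [Fintype.piFinset_univ] at h
  simp_rw [Fintype.expect_eq_sum_div_card]
  rw [prod_div_distrib, h]
  simp

end Fourier

/-- The spectral gap of the lazy walk with a nonzero step on `𝔽_p`. -/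
lemma exists_spectral_gap (p : ℕ) [NeZero p] :
    ∃ ρ : ℝ, 0 < ρ ∧ ρ < 1 ∧ ∀ k : ZMod p, k ≠ 0 →
      ‖(1 + ZMod.stdAddChar k : ℂ) / 2‖ ^ 2 ≤ 1 - ρ := by
  have hlt (k : ZMod p) (hk : k ≠ 0) : ‖(1 + ZMod.stdAddChar k : ℂ) / 2‖ ^ 2 < 1 := by
    set z : ℂ := ZMod.stdAddChar k with hz
    have h1 : ‖z‖ = 1 := AddChar.norm_apply _ _
    have hne : z ≠ 1 := fun h ↦ hk (ZMod.injective_stdAddChar (by simpa using h))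
    have hpar := parallelogram_law_with_norm ℝ (1 : ℂ) z
    have hpos : 0 < ‖1 - z‖ := norm_pos_iff.mpr (sub_ne_zero.mpr hne.symm)
    rw [norm_one, h1] at hpar
    rw [norm_div, div_pow, Complex.norm_ofNat]
    nlinarith
  let s : Finset ℝ := insert (1 / 2)
    ((univ.filter fun k : ZMod p ↦ k ≠ 0).image fun k ↦ 1 - ‖(1 + ZMod.stdAddChar k : ℂ) / 2‖ ^ 2)
  have hs : s.Nonempty := insert_nonempty _ _
  refine ⟨s.min' hs, ?_, ?_, fun k hk ↦ ?_⟩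
  · rw [lt_min'_iff]
    intro y hy
    simp only [s, mem_insert, mem_image, mem_filter, mem_univ, true_and] at hy
    rcases hy with rfl | ⟨k, hk, rfl⟩
    · norm_num
    · linarith [hlt k hk]
  · exact (min'_le s (1 / 2) (mem_insert_self _ _)).trans_lt (by norm_num)
  · have := min'_le s (1 - ‖(1 + ZMod.stdAddChar k : ℂ) / 2‖ ^ 2)
      (mem_insert_of_mem (mem_image_of_mem _ (by simp [hk])))
    linarith

section BoxForm

variable {ι : Type*} {p : ℕ}

/-- The vector with coordinates `γ` where `c` is true and `0` elsewhere. -/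
def cubeVec (γ : ZMod p) (c : ι → Bool) : ι → ZMod p := fun i ↦ if c i then γ else 0

/-- The restriction of a vector to the coordinates in `S`, extended by zero. -/
def maskVec [DecidableEq ι] (S : Finset ι) (e : ι → ZMod p) : ι → ZMod p :=
  fun i ↦ if i ∈ S then e i else 0

lemma maskVec_add [DecidableEq ι] (S : Finset ι) (d e : ι → ZMod p) :
    maskVec S (d + e) = maskVec S d + maskVec S e := by
  ext i; simp only [maskVec, Pi.add_apply]; split_ifs <;> simp

lemma maskVec_maskVec [DecidableEq ι] {S U : Finset ι} (h : U ⊆ S) (e : ι → ZMod p) :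
    maskVec S (maskVec U e) = maskVec U e := by
  ext i; simp only [maskVec]
  by_cases hU : i ∈ U
  · simp [hU, h hU]
  · simp [hU]

variable [Fintype ι] [DecidableEq ι] [NeZero p]

lemma norm_expect_cubeVec_le [Fact p.Prime] {ρ : ℝ}
    (hρ : ∀ k : ZMod p, k ≠ 0 → ‖(1 + ZMod.stdAddChar k : ℂ) / 2‖ ^ 2 ≤ 1 - ρ)
    {γ : ZMod p} (hγ : γ ≠ 0) (r : ι → ZMod p) :
    ‖𝔼 c, dotChar r (cubeVec γ c)‖ ^ 2 ≤ ∏ i, (ρ * (if r i = 0 then 1 else 0) + (1 - ρ)) := by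
  simp_rw [dotChar_eq_prod, cubeVec]
  rw [expect_prod_bool (fun i b ↦ ZMod.stdAddChar (r i * if b then γ else 0)), norm_prod,
    ← prod_pow]
  refine prod_le_prod (fun i _ ↦ by positivity) fun i _ ↦ ?_
  have h : 𝔼 b : Bool, (ZMod.stdAddChar (r i * if b then γ else 0) : ℂ) =
      (1 + ZMod.stdAddChar (r i * γ)) / 2 := by
    rw [Fintype.expect_eq_sum_div_card]
    simp [add_comm]
  rw [h]
  split_ifs with hr
  · simp [hr]
  · simpa using hρ _ (mul_ne_zero hr hγ)

lemma expect_sq_cubeVec_le [Fact p.Prime] {ρ : ℝ} (hρ0 : 0 ≤ ρ) (hρ1 : ρ ≤ 1)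
    (hρ : ∀ k : ZMod p, k ≠ 0 → ‖(1 + ZMod.stdAddChar k : ℂ) / 2‖ ^ 2 ≤ 1 - ρ)
    {γ : ZMod p} (hγ : γ ≠ 0) (F : (ι → ZMod p) → ℝ) :
    𝔼 x, (𝔼 c, F (x + cubeVec γ c)) ^ 2 ≤
      ∑ S : Finset ι, (ρ ^ #S * (1 - ρ) ^ #Sᶜ) * 𝔼 x, (𝔼 e, F (x + maskVec S e)) ^ 2 := by
  simp_rw [expect_expect_shift_sq, mul_sum]
  rw [sum_comm]
  refine sum_le_sum fun r _ ↦ ?_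
  have h1ρ : 0 ≤ 1 - ρ := by linarith
  calc _ ≤ ‖dotFourier F r‖ ^ 2 * ∏ i, (ρ * (if r i = 0 then 1 else 0) + (1 - ρ)) := by
        gcongr; exact norm_expect_cubeVec_le hρ hγ r
    _ = ∑ S : Finset ι, (ρ ^ #S * (1 - ρ) ^ #Sᶜ) *
          (‖dotFourier F r‖ ^ 2 * ∏ i ∈ S, (if r i = 0 then 1 else 0)) := by
        rw [Fintype.prod_add, mul_sum]
        refine sum_congr rfl fun S _ ↦ ?_
        rw [prod_mul_distrib, prod_const, prod_const]
        ring
    _ ≤ _ := by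
        refine sum_le_sum fun S _ ↦ ?_
        gcongr
        by_cases h : ∀ i ∈ S, r i = 0
        · have : ∀ e : ι → ZMod p, dotChar r (maskVec S e) = 1 := fun e ↦ by
            rw [dotChar_eq_prod]
            refine prod_eq_one fun i _ ↦ ?_
            by_cases hi : i ∈ S <;> simp [maskVec, hi, h]
          simp_rw [this]
          rw [prod_congr rfl fun i hi ↦ if_pos (h i hi)]
          simp
        · push Not at h
          obtain ⟨i, hi, hri⟩ := h
          rw [prod_eq_zero hi (if_neg hri)]
          positivity

/-- The sum of squares of second differences of `f` along the directions `u` and `w`. -/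
noncomputable def boxForm {κ μ : Type*} [Fintype κ] [Fintype μ] (u : κ → ι → ZMod p)
    (w : μ → ι → ZMod p) (f : (ι → ZMod p) → ℝ) : ℝ :=
  𝔼 b, 𝔼 b', 𝔼 x, (𝔼 c, f (x + w c + u b) * f (x + w c + u b')) ^ 2

lemma expect_rotate {α β γ : Type*} [Fintype α] [Fintype β] [Fintype γ] (g : α → β → γ → ℝ) :
    𝔼 a, 𝔼 b, 𝔼 c, g a b c = 𝔼 c, 𝔼 a, 𝔼 b, g a b c := by
  rw [expect_comm univ univ (fun c a ↦ 𝔼 b, g a b c)]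
  exact expect_congr rfl fun a _ ↦ expect_comm _ _ _

section
variable {κ μ : Type*} [Fintype κ] [Fintype μ] (u : κ → ι → ZMod p) (w : μ → ι → ZMod p)
  (f : (ι → ZMod p) → ℝ)

lemma boxForm_eq :
    boxForm u w f = 𝔼 x, 𝔼 b, 𝔼 b', 𝔼 c, 𝔼 c', f (x + w c + u b) * f (x + w c + u b') *
      (f (x + w c' + u b) * f (x + w c' + u b')) := by
  simp_rw [boxForm, sq, expect_mul_expect]
  rw [expect_rotate]

lemma boxForm_comm : boxForm u w f = boxForm w u f := by
  rw [boxForm_eq, boxForm_eq]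
  refine expect_congr rfl fun x _ ↦ ?_
  rw [expect_rotate]
  refine expect_congr rfl fun c _ ↦ ?_
  rw [expect_rotate]
  refine expect_congr rfl fun c' _ ↦ expect_congr rfl fun b _ ↦ expect_congr rfl fun b' _ ↦ ?_
  simp only [add_right_comm x (u _) (w _)]
  ring

variable {f}

lemma boxForm_le_one [Nonempty κ] [Nonempty μ] (hf : ∀ x, |f x| ≤ 1) : boxForm u w f ≤ 1 := by
  refine expect_le univ_nonempty fun b _ ↦ expect_le univ_nonempty fun b' _ ↦
    expect_le univ_nonempty fun x _ ↦ ?_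
  rw [sq_le_one_iff_abs_le_one]
  refine (abs_expect_le _ _).trans (expect_le univ_nonempty fun c _ ↦ ?_)
  rw [abs_mul]
  exact mul_le_one₀ (hf _) (abs_nonneg _) (hf _)

variable (f)

lemma boxForm_cubeVec_le [Fact p.Prime] {ρ : ℝ} (hρ0 : 0 ≤ ρ) (hρ1 : ρ ≤ 1)
    (hρ : ∀ k : ZMod p, k ≠ 0 → ‖(1 + ZMod.stdAddChar k : ℂ) / 2‖ ^ 2 ≤ 1 - ρ)
    {γ : ZMod p} (hγ : γ ≠ 0) :
    boxForm u (cubeVec γ) f ≤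
      ∑ S : Finset ι, (ρ ^ #S * (1 - ρ) ^ #Sᶜ) * boxForm u (maskVec S) f := by
  have h : ∑ S : Finset ι, (ρ ^ #S * (1 - ρ) ^ #Sᶜ) * boxForm u (maskVec S) f =
      𝔼 b, 𝔼 b', ∑ S : Finset ι, (ρ ^ #S * (1 - ρ) ^ #Sᶜ) *
        𝔼 x, (𝔼 e, f (x + maskVec S e + u b) * f (x + maskVec S e + u b')) ^ 2 := by
    simp_rw [expect_sum_comm, ← mul_expect]
    rfl
  rw [h]
  refine expect_le_expect fun b _ ↦ expect_le_expect fun b' _ ↦ ?_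
  exact expect_sq_cubeVec_le hρ0 hρ1 hρ hγ fun x ↦ f (x + u b) * f (x + u b')

lemma expect_sq_maskVec_mono {S U : Finset ι} (h : U ⊆ S) (F : (ι → ZMod p) → ℝ) :
    𝔼 x, (𝔼 e, F (x + maskVec S e)) ^ 2 ≤ 𝔼 x, (𝔼 e, F (x + maskVec U e)) ^ 2 := by
  have hS (x : ι → ZMod p) : 𝔼 e, F (x + maskVec S e) =
      𝔼 d, 𝔼 e, F (x + maskVec S d + maskVec U e) := by
    rw [expect_comm]
    refine (Fintype.expect_const (ι := ι → ZMod p) (𝔼 e, F (x + maskVec S e))).symm.trans ?_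
    refine expect_congr rfl fun e _ ↦ ?_
    refine (Fintype.expect_equiv (Equiv.addRight (maskVec U e)) _ _ fun d ↦ ?_).symm
    rw [Equiv.coe_addRight, maskVec_add, maskVec_maskVec h, add_assoc]
  have hshift (d : ι → ZMod p) : 𝔼 x, (𝔼 e, F (x + maskVec S d + maskVec U e)) ^ 2 =
      𝔼 x, (𝔼 e, F (x + maskVec U e)) ^ 2 :=
    Fintype.expect_equiv (Equiv.addRight (maskVec S d)) _ _ fun x ↦ by rw [Equiv.coe_addRight]
  have hjensen (x : ι → ZMod p) : (𝔼 e, F (x + maskVec S e)) ^ 2 ≤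
      𝔼 d, (𝔼 e, F (x + maskVec S d + maskVec U e)) ^ 2 := by
    rw [hS]
    simpa using expect_mul_sq_le_sq_mul_sq univ (fun _ : ι → ZMod p ↦ (1 : ℝ))
      (fun d ↦ 𝔼 e, F (x + maskVec S d + maskVec U e))
  refine (expect_le_expect fun x _ ↦ hjensen x).trans ?_
  rw [expect_comm]
  simp_rw [hshift]
  rw [Fintype.expect_const]

lemma boxForm_maskVec_mono {S U : Finset ι} (h : U ⊆ S) :
    boxForm u (maskVec S) f ≤ boxForm u (maskVec U) f :=
  expect_le_expect fun b _ ↦ expect_le_expect fun b' _ ↦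
    expect_sq_maskVec_mono h fun x ↦ f (x + u b) * f (x + u b')

end

omit [NeZero p] in
lemma exists_large_inter {ρ : ℝ} (hρ0 : 0 ≤ ρ) (hρ1 : ρ ≤ 1) {W : Finset ι → ℝ}
    (hW : ∀ S, W S ≤ 1) {ε : ℝ} (T : Finset ι) (t : ℕ)
    (ht : (1 - ρ / 2) ^ #T * 2 ^ t < ε / 2)
    (hε : ε ≤ ∑ S : Finset ι, (ρ ^ #S * (1 - ρ) ^ #Sᶜ) * W S) :
    ∃ S, t ≤ #(S ∩ T) ∧ ε / 2 ≤ W S := by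
  by_contra! hcon
  have hε0 : 0 ≤ ε / 2 := ht.le.trans' (by have : 0 ≤ 1 - ρ / 2 := by linarith
                                           positivity)
  have h1ρ : 0 ≤ 1 - ρ := by linarith
  have hbound (S : Finset ι) : W S ≤ ε / 2 + 2 ^ t * (1 / 2) ^ #(S ∩ T) := by
    by_cases h : t ≤ #(S ∩ T)
    · have := hcon S h
      have : (0 : ℝ) ≤ 2 ^ t * (1 / 2) ^ #(S ∩ T) := by positivity
      linarith
    · have : (1 : ℝ) ≤ 2 ^ t * (1 / 2) ^ #(S ∩ T) := by
        rw [one_div, inv_pow, ← div_eq_mul_inv, le_div_iff₀ (by positivity), one_mul]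
        exact pow_le_pow_right₀ (by norm_num) (by omega)
      linarith [hW S]
  have hsum : ∑ S : Finset ι, (ρ ^ #S * (1 - ρ) ^ #Sᶜ) = 1 := by
    have := Fintype.prod_add (fun _ : ι ↦ ρ) (fun _ ↦ 1 - ρ)
    simp only [prod_const] at this
    rw [← this]; simp
  have hsum' : ∑ S : Finset ι, (ρ ^ #S * (1 - ρ) ^ #Sᶜ) * (1 / 2) ^ #(S ∩ T) =
      (1 - ρ / 2) ^ #T := by
    have := Fintype.prod_add (fun i : ι ↦ ρ * if i ∈ T then 1 / 2 else 1) (fun _ ↦ 1 - ρ)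
    have h2 : ∏ i, ((ρ * if i ∈ T then 1 / 2 else 1) + (1 - ρ)) = (1 - ρ / 2) ^ #T := by
      rw [← prod_const, ← Fintype.prod_ite_mem T]
      refine prod_congr rfl fun i _ ↦ ?_
      split_ifs <;> ring
    rw [← h2, this]
    refine sum_congr rfl fun S _ ↦ ?_
    rw [prod_mul_distrib, prod_const, prod_const, ← prod_filter, prod_const,
      filter_mem_eq_inter]
    ring
  have : ∑ S : Finset ι, (ρ ^ #S * (1 - ρ) ^ #Sᶜ) * W S ≤
      ε / 2 + 2 ^ t * (1 - ρ / 2) ^ #T := by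
    calc _ ≤ ∑ S : Finset ι, (ρ ^ #S * (1 - ρ) ^ #Sᶜ) *
          (ε / 2 + 2 ^ t * (1 / 2) ^ #(S ∩ T)) := by
          gcongr with S; exact hbound S
      _ = _ := by
          simp_rw [mul_add]
          rw [sum_add_distrib, ← sum_mul, hsum, ← hsum', mul_sum]
          congr 1
          · ring
          · exact sum_congr rfl fun S _ ↦ by ring
  linarith

end BoxForm

/-- A function with large second differences along two cubes has large second differences along
a full coordinate subspace of proportional dimension. -/
lemma exists_boxForm_maskVec (p : ℕ) [NeZero p] [Fact p.Prime] :
    ∃ K : ℕ, 0 < K ∧ ∀ (ι : Type) [Fintype ι] [DecidableEq ι] (t : ℕ) (ε : ℝ) (α γ : ZMod p)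
      (f : (ι → ZMod p) → ℝ), α ≠ 0 → γ ≠ 0 → (∀ x, |f x| ≤ 1) → K * (K * t) ≤ Fintype.card ι →
      (1 / 2) ^ t < ε / 4 → ε ≤ boxForm (cubeVec α) (cubeVec γ) f →
      ∃ U : Finset ι, t ≤ #U ∧ ε / 4 ≤ boxForm (maskVec U) (maskVec U) f := by
  obtain ⟨ρ, hρ0, hρ1, hρ⟩ := exists_spectral_gap p
  obtain ⟨K, hK⟩ := exists_pow_lt_of_lt_one (show (0 : ℝ) < 1 / 4 by norm_num)
    (show 1 - ρ / 2 < 1 by linarith)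
  have hK0 : 0 < K := by
    rcases Nat.eq_zero_or_pos K with rfl | h
    · norm_num at hK
    · exact h
  have h0 : 0 ≤ 1 - ρ / 2 := by linarith
  have hdecay (s m : ℕ) (h : K * s ≤ m) : (1 - ρ / 2) ^ m * 2 ^ s ≤ (1 / 2) ^ s := by
    calc _ ≤ (1 - ρ / 2) ^ (K * s) * 2 ^ s := by
          gcongr ?_ * _
          exact pow_le_pow_of_le_one h0 (by linarith) h
      _ ≤ (1 / 4) ^ s * 2 ^ s := by
          rw [pow_mul]; gcongr
      _ = (1 / 2) ^ s := by rw [← mul_pow]; norm_num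
  refine ⟨K, hK0, fun ι _ _ t ε α γ f hα hγ hf hcard ht hε ↦ ?_⟩
  have hε0 : 0 < ε := by have : (0 : ℝ) < (1 / 2) ^ t := by positivity
                         linarith
  obtain ⟨S, hS, hWS⟩ := exists_large_inter hρ0.le hρ1.le
    (fun S ↦ boxForm_le_one (cubeVec α) (maskVec S) hf) univ (K * t)
    ((hdecay (K * t) _ (by simpa using hcard)).trans_lt
      ((pow_le_pow_of_le_one (by norm_num) (by norm_num)
        (Nat.le_mul_of_pos_left t hK0)).trans_lt (by linarith)))
    (hε.trans (boxForm_cubeVec_le (cubeVec α) f hρ0.le hρ1.le hρ hγ))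
  rw [inter_univ] at hS
  rw [boxForm_comm] at hWS
  obtain ⟨S', hS', hWS'⟩ := exists_large_inter hρ0.le hρ1.le
    (fun S' ↦ boxForm_le_one (maskVec S) (maskVec S') hf) S t
    ((hdecay t _ hS).trans_lt (by linarith))
    (hWS.trans (boxForm_cubeVec_le (maskVec S) f hρ0.le hρ1.le hρ hα))
  refine ⟨S' ∩ S, hS', ?_⟩
  calc ε / 4 = ε / 2 / 2 := by ring
    _ ≤ boxForm (maskVec S) (maskVec S') f := hWS'
    _ ≤ boxForm (maskVec S) (maskVec (S' ∩ S)) f :=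
        boxForm_maskVec_mono _ f inter_subset_left
    _ = boxForm (maskVec (S' ∩ S)) (maskVec S) f := boxForm_comm _ _ _
    _ ≤ _ := boxForm_maskVec_mono _ f inter_subset_right

section Increment

variable {ι : Type*} {p : ℕ} [Fintype ι] [DecidableEq ι] [NeZero p]

/-- The `U²` inverse theorem: a bounded function whose second differences are large on average
correlates with a character. -/
lemma exists_dotFourier_of_box {g : (ι → ZMod p) → ℝ} (hg : ∀ x, |g x| ≤ 1) :
    ∃ r, 𝔼 d, (𝔼 t, g t * g (t + d)) ^ 2 ≤ ‖dotFourier g r‖ := by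
  have hF (r : ι → ZMod p) : dotFourier (fun d ↦ 𝔼 t, g t * g (t + d)) r =
      conj (dotFourier g r) * dotFourier g r := by
    simp only [dotFourier, Complex.ofReal_expect, expect_mul, map_expect]
    rw [expect_comm]
    refine expect_congr rfl fun t _ ↦ ?_
    rw [mul_expect]
    refine Fintype.expect_equiv (Equiv.addLeft t) _ _ fun d ↦ ?_
    have : dotChar r d = dotChar r (-t) * dotChar r (t + d) := by
      rw [← dotChar_add]; simp
    simp only [Equiv.coe_addLeft, map_mul, Complex.conj_ofReal, conj_dotChar, this,
      Complex.ofReal_mul]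
    ring
  obtain ⟨r, hr⟩ := Finite.exists_max fun r : ι → ZMod p ↦ ‖dotFourier g r‖ ^ 2
  have hsum : ∑ r, ‖dotFourier g r‖ ^ 2 ≤ 1 := by
    rw [sum_norm_dotFourier_sq]
    exact expect_le univ_nonempty fun x _ ↦ (sq_le_one_iff_abs_le_one _).mpr (hg x)
  have hr1 : ‖dotFourier g r‖ ≤ 1 := by
    have := (single_le_sum (f := fun r ↦ ‖dotFourier g r‖ ^ 2) (fun _ _ ↦ by positivity)
      (mem_univ r)).trans hsum
    exact (sq_le_one_iff₀ (norm_nonneg _)).mp this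
  refine ⟨r, ?_⟩
  rw [← sum_norm_dotFourier_sq]
  calc _ = ∑ s, ‖dotFourier g s‖ ^ 2 * ‖dotFourier g s‖ ^ 2 := by
        refine sum_congr rfl fun s _ ↦ ?_
        rw [hF, norm_mul, RCLike.norm_conj, mul_pow]
    _ ≤ ∑ s, ‖dotFourier g r‖ ^ 2 * ‖dotFourier g s‖ ^ 2 := by
        exact sum_le_sum fun s _ ↦ mul_le_mul_of_nonneg_right (hr s) (by positivity)
    _ ≤ ‖dotFourier g r‖ ^ 2 * 1 := by
        rw [← mul_sum]; gcongr
    _ ≤ ‖dotFourier g r‖ := by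
        rw [mul_one, sq]
        exact mul_le_of_le_one_left (norm_nonneg _) hr1

lemma boxForm_maskVec_eq (U : Finset ι) (f : (ι → ZMod p) → ℝ) :
    boxForm (maskVec U) (maskVec U) f =
      𝔼 x, 𝔼 d, (𝔼 t, f (x + maskVec U t) * f (x + maskVec U (t + d))) ^ 2 := by
  rw [boxForm, expect_rotate]
  refine expect_congr rfl fun x _ ↦ ?_
  have h (b : ι → ZMod p) :
      𝔼 b', (𝔼 c, f (x + maskVec U c + maskVec U b) * f (x + maskVec U c + maskVec U b')) ^ 2 =
        𝔼 d, (𝔼 t, f (x + maskVec U t) * f (x + maskVec U (t + d))) ^ 2 := by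
    refine (Fintype.expect_equiv (Equiv.addRight b) _ _ fun d ↦ ?_).symm
    congr 1
    refine (Fintype.expect_equiv (Equiv.addRight b) _ _ fun c ↦ ?_).symm
    simp only [Equiv.coe_addRight, maskVec_add]
    congr 2 <;> abel
  simp_rw [h]
  rw [Fintype.expect_const]

omit [Fintype ι] [DecidableEq ι] [NeZero p] in
/-- The linear embedding of `𝔽_p^μ` repeating the coordinate `j` at all the places `e (j, k)`. -/
noncomputable def spreadVec {μ κ : Type*} (e : μ × κ → ι) (y : μ → ZMod p) : ι → ZMod p :=
  Function.extend e (fun jk ↦ y jk.1) 0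

section
omit [Fintype ι] [DecidableEq ι] [NeZero p]
variable {μ κ : Type*} {e : μ × κ → ι} (he : Function.Injective e)

include he in
lemma spreadVec_apply (y : μ → ZMod p) (jk : μ × κ) : spreadVec e y (e jk) = y jk.1 :=
  he.extend_apply _ _ _

lemma spreadVec_apply_of_notMem (y : μ → ZMod p) {i : ι} (hi : ¬∃ jk, e jk = i) :
    spreadVec e y i = 0 :=
  Function.extend_apply' _ _ _ hi

include he in
lemma spreadVec_add (y z : μ → ZMod p) :
    spreadVec e (y + z) = spreadVec e y + spreadVec e z := by
  ext i
  by_cases hi : ∃ jk, e jk = i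
  · obtain ⟨jk, rfl⟩ := hi
    simp [spreadVec_apply he]
  · simp [spreadVec_apply_of_notMem _ hi]

lemma maskVec_spreadVec [DecidableEq ι] {U : Finset ι} (hU : ∀ jk, e jk ∈ U)
    (y : μ → ZMod p) : maskVec U (spreadVec e y) = spreadVec e y := by
  ext i
  by_cases hi : ∃ jk, e jk = i
  · obtain ⟨jk, rfl⟩ := hi
    simp [maskVec, hU]
  · simp [maskVec, spreadVec_apply_of_notMem _ hi]

end

omit [DecidableEq ι] in
lemma dotChar_spreadVec {μ : Type*} [Fintype μ] {e : μ × Fin p → ι}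
    (he : Function.Injective e) {r : ι → ZMod p} {c : ZMod p} (hr : ∀ jk, r (e jk) = c)
    (y : μ → ZMod p) : dotChar r (spreadVec e y) = 1 := by
  have : r ⬝ᵥ spreadVec e y = 0 := by
    rw [dotProduct, ← sum_subset (subset_univ (univ.map ⟨e, he⟩))]
    · rw [sum_map, Fintype.sum_prod_type]
      simp [hr, spreadVec_apply he]
    · intro i _ hi
      rw [spreadVec_apply_of_notMem, mul_zero]
      simpa using hi
  rw [dotChar, this, AddChar.map_zero_eq_one]

omit [Fintype ι] [DecidableEq ι] in
lemma exists_blocks (U : Finset ι) (r : ι → ZMod p) (m : ℕ) (h : p * (p * m) ≤ #U) :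
    ∃ (e : Fin m × Fin p → ι) (c : ZMod p), Function.Injective e ∧ (∀ jk, e jk ∈ U) ∧
      ∀ jk, r (e jk) = c := by
  obtain ⟨c, -, hc⟩ := exists_le_card_fiber_of_mul_le_card_of_maps_to (s := U)
    (t := (univ : Finset (ZMod p))) (f := r) (n := p * m) (fun _ _ ↦ mem_univ _) univ_nonempty
    (by simpa [ZMod.card] using h)
  obtain ⟨g⟩ : Nonempty (Fin m × Fin p ↪ {x // x ∈ U.filter fun i ↦ r i = c}) := by
    apply Function.Embedding.nonempty_of_card_le
    simpa [mul_comm] using hc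
  refine ⟨fun jk ↦ g jk, c, Subtype.val_injective.comp g.injective, fun jk ↦ ?_, fun jk ↦ ?_⟩
  · exact (mem_filter.mp (g jk).2).1
  · exact (mem_filter.mp (g jk).2).2

/-- A bounded function of mean zero with large second differences along a coordinate subspace has
a large mean on a combinatorial subspace. -/
lemma exists_spreadVec_increment {f : (ι → ZMod p) → ℝ} (hf : ∀ x, |f x| ≤ 1)
    (hf0 : 𝔼 x, f x = 0) (U : Finset ι) {m : ℕ} (hU : p * (p * m) ≤ #U) {η : ℝ}
    (hη0 : 0 < η) (hη : η ≤ boxForm (maskVec U) (maskVec U) f) :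
    ∃ (x : ι → ZMod p) (e : Fin m × Fin p → ι), Function.Injective e ∧
      η / 2 ≤ 𝔼 y, f (x + spreadVec e y) := by
  have hx (x : ι → ZMod p) : ∃ e : Fin m × Fin p → ι, Function.Injective e ∧
      (∀ jk, e jk ∈ U) ∧ 𝔼 d, (𝔼 t, f (x + maskVec U t) * f (x + maskVec U (t + d))) ^ 2 ≤
        𝔼 t, |𝔼 y, f (x + maskVec U t + spreadVec e y)| := by
    obtain ⟨r, hr⟩ := exists_dotFourier_of_box (g := fun t ↦ f (x + maskVec U t)) fun t ↦ hf _
    obtain ⟨e, c, he, heU, hec⟩ := exists_blocks U r m hU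
    refine ⟨e, he, heU, hr.trans ?_⟩
    have : dotFourier (fun t ↦ f (x + maskVec U t)) r =
        𝔼 t, ((𝔼 y, f (x + maskVec U t + spreadVec e y) : ℝ) : ℂ) * dotChar r t := by
      simp_rw [Complex.ofReal_expect, expect_mul]
      rw [expect_comm, dotFourier]
      refine (Fintype.expect_const (ι := Fin m → ZMod p) _).symm.trans ?_
      refine expect_congr rfl fun y _ ↦ ?_
      refine (Fintype.expect_equiv (Equiv.addRight (spreadVec e y)) _ _ fun t ↦ ?_).symm
      rw [Equiv.coe_addRight, maskVec_add, maskVec_spreadVec heU, dotChar_add,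
        dotChar_spreadVec he hec, mul_one, add_assoc]
    rw [this]
    refine (RCLike.norm_expect_le (K := ℂ)).trans (le_of_eq (expect_congr rfl fun t _ ↦ ?_))
    rw [norm_mul, norm_dotChar, mul_one, Complex.norm_real, Real.norm_eq_abs]
  choose e he heU hle using hx
  have hzero : 𝔼 x, 𝔼 t, 𝔼 y, f (x + maskVec U t + spreadVec (e x) y) = 0 := by
    have h1 (x : ι → ZMod p) : 𝔼 t, 𝔼 y, f (x + maskVec U t + spreadVec (e x) y) =
        𝔼 t, f (x + maskVec U t) := by
      rw [expect_comm]
      refine Eq.trans ?_ (Fintype.expect_const (ι := Fin m → ZMod p) _)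
      refine expect_congr rfl fun y _ ↦ ?_
      refine Fintype.expect_equiv (Equiv.addRight (spreadVec (e x) y)) _ _ fun t ↦ ?_
      rw [Equiv.coe_addRight, maskVec_add, maskVec_spreadVec (heU x), add_assoc]
    simp_rw [h1]
    rw [expect_comm]
    refine expect_eq_zero fun t _ ↦ ?_
    rw [← hf0]
    exact Fintype.expect_equiv (Equiv.addRight (maskVec U t)) _ _ fun x ↦ rfl
  have hmain : η ≤ 𝔼 x, 𝔼 t, (|𝔼 y, f (x + maskVec U t + spreadVec (e x) y)| +
      𝔼 y, f (x + maskVec U t + spreadVec (e x) y)) := by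
    simp_rw [expect_add_distrib]
    rw [hzero, add_zero]
    refine hη.trans ?_
    rw [boxForm_maskVec_eq]
    exact expect_le_expect fun x _ ↦ hle x
  obtain ⟨x, -, hx⟩ := exists_le_of_le_expect univ_nonempty hmain
  obtain ⟨t, -, ht⟩ := exists_le_of_le_expect univ_nonempty hx
  refine ⟨x + maskVec U t, e x, he x, ?_⟩
  rcases abs_cases (𝔼 y, f (x + maskVec U t + spreadVec (e x) y)) with h | h <;> linarith [h.1]

end Increment

section Counting

lemma expect_mul_sq_le_expect_sq {κ : Type*} [Fintype κ] [Nonempty κ] {g : κ → ℝ}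
    (hg : ∀ i, |g i| ≤ 1) (h : κ → ℝ) : (𝔼 i, g i * h i) ^ 2 ≤ 𝔼 i, h i ^ 2 :=
  (expect_mul_sq_le_sq_mul_sq _ _ _).trans <|
    mul_le_of_le_one_left (expect_nonneg fun _ _ ↦ sq_nonneg _) <|
      expect_le univ_nonempty fun i _ ↦ (sq_le_one_iff_abs_le_one _).mpr (hg i)

lemma expect_sq_le_expect_sq {κ : Type*} [Fintype κ] [Nonempty κ] (h : κ → ℝ) :
    (𝔼 i, h i) ^ 2 ≤ 𝔼 i, h i ^ 2 := by
  simpa using expect_mul_sq_le_expect_sq (g := fun _ ↦ 1) (by simp) h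

variable {ι : Type*} {p : ℕ} [Fintype ι] [DecidableEq ι] [NeZero p]

lemma expect_pow_four_le_boxForm {κ μ : Type*} [Fintype κ] [Fintype μ] [Nonempty κ] [Nonempty μ]
    (u : κ → ι → ZMod p) (w : μ → ι → ZMod p) (f : (ι → ZMod p) → ℝ)
    {G : (ι → ZMod p) → μ → ℝ} {H : (ι → ZMod p) → κ → ℝ} (hG : ∀ v c, |G v c| ≤ 1)
    (hH : ∀ v b, |H v b| ≤ 1) :
    (𝔼 v, 𝔼 c, 𝔼 b, G v c * (H v b * f (v + w c + u b))) ^ 4 ≤ boxForm u w f := by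
  have h1 : (𝔼 v, 𝔼 c, 𝔼 b, G v c * (H v b * f (v + w c + u b))) ^ 2 ≤
      𝔼 v, 𝔼 c, (𝔼 b, H v b * f (v + w c + u b)) ^ 2 := by
    refine (expect_sq_le_expect_sq _).trans (expect_le_expect fun v _ ↦ ?_)
    simp_rw [← mul_expect]
    exact expect_mul_sq_le_expect_sq (hG v) _
  have h2 : 𝔼 v, 𝔼 c, (𝔼 b, H v b * f (v + w c + u b)) ^ 2 =
      𝔼 b, 𝔼 b', 𝔼 v, (H v b * H v b') * 𝔼 c, f (v + w c + u b) * f (v + w c + u b') := by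
    refine Eq.trans ?_ (expect_rotate _).symm
    refine expect_congr rfl fun v _ ↦ ?_
    simp_rw [sq, expect_mul_expect, mul_expect]
    rw [expect_comm]
    refine expect_congr rfl fun b _ ↦ ?_
    rw [expect_comm]
    refine expect_congr rfl fun b' _ ↦ expect_congr rfl fun c _ ↦ ?_
    ring
  calc _ = ((𝔼 v, 𝔼 c, 𝔼 b, G v c * (H v b * f (v + w c + u b))) ^ 2) ^ 2 := by ring
    _ ≤ (𝔼 b, 𝔼 b', 𝔼 v, (H v b * H v b') *
          𝔼 c, f (v + w c + u b) * f (v + w c + u b')) ^ 2 := by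
        rw [← h2]; gcongr
    _ ≤ _ := by
        refine (expect_sq_le_expect_sq _).trans (expect_le_expect fun b _ ↦ ?_)
        refine (expect_sq_le_expect_sq _).trans (expect_le_expect fun b' _ ↦ ?_)
        refine expect_mul_sq_le_expect_sq (fun v ↦ ?_) _
        rw [abs_mul]
        exact mul_le_one₀ (hH v b) (abs_nonneg _) (hH v b')

/-- `A` contains no progression `x, x + a, x + 2a` with nonzero difference `a ∈ {0, 1, 2}^ι`. -/
def RestrictedAPFree {ι : Type*} {p : ℕ} (A : Finset (ι → ZMod p)) : Prop :=
  ∀ x a : ι → ZMod p, (∀ i, a i = 0 ∨ a i = 1 ∨ a i = 2) → a ≠ 0 →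
    ¬(x ∈ A ∧ x + a ∈ A ∧ x + 2 • a ∈ A)

/-- The real-valued indicator function of a finset. -/
def ind {α : Type*} [DecidableEq α] (A : Finset α) (x : α) : ℝ := if x ∈ A then 1 else 0

lemma ind_nonneg {α : Type*} [DecidableEq α] (A : Finset α) (x : α) : 0 ≤ ind A x := by
  unfold ind; positivity

lemma ind_le_one {α : Type*} [DecidableEq α] (A : Finset α) (x : α) : ind A x ≤ 1 := by
  unfold ind; split_ifs <;> norm_num

lemma abs_ind_le_one {α : Type*} [DecidableEq α] (A : Finset α) (x : α) : |ind A x| ≤ 1 := by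
  rw [abs_of_nonneg (ind_nonneg A x)]; exact ind_le_one A x

lemma expect_ind_le_one {α : Type*} [Fintype α] [DecidableEq α] (A : Finset α) :
    𝔼 x, ind A x ≤ 1 := by
  rcases isEmpty_or_nonempty α with h | h
  · simp
  · exact expect_le univ_nonempty fun x _ ↦ ind_le_one A x

lemma expect_ind_nonneg {α : Type*} [Fintype α] [DecidableEq α] (A : Finset α) :
    0 ≤ 𝔼 x, ind A x := expect_nonneg fun x _ ↦ ind_nonneg A x

omit [Fintype ι] [DecidableEq ι] [NeZero p] in
lemma two_nsmul_cubeVec_one (c : ι → Bool) :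
    2 • cubeVec (1 : ZMod p) c = cubeVec 2 c := by
  ext i; simp only [cubeVec, Pi.smul_apply]; split_ifs <;> simp

omit [DecidableEq ι] [NeZero p] in
lemma RestrictedAPFree.ind_mul_le [Fact p.Prime] (hp2 : p ≠ 2)
    [DecidableEq (ι → ZMod p)] {A : Finset (ι → ZMod p)}
    (hA : RestrictedAPFree A) (v : ι → ZMod p) (b c : ι → Bool) :
    ind A (v + cubeVec 1 c) * (ind A (v - cubeVec 1 b) * ind A (v + cubeVec 2 c + cubeVec 1 b)) ≤
      if b = fun _ ↦ false then 1 else 0 := by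
  split_ifs with hb
  · exact mul_le_one₀ (ind_le_one _ _) (mul_nonneg (ind_nonneg _ _) (ind_nonneg _ _))
      (mul_le_one₀ (ind_le_one _ _) (ind_nonneg _ _) (ind_le_one _ _))
  obtain ⟨i, hi⟩ : ∃ i, b i = true := by
    by_contra! h
    exact hb (funext fun i ↦ by simpa using h i)
  have h2 : (2 : ZMod p) ≠ 0 := Ring.two_ne_zero (by rwa [ZMod.ringChar_zmod_n])
  have := hA (v - cubeVec 1 b) (cubeVec 1 b + cubeVec 1 c) (fun i ↦ by
    simp only [cubeVec, Pi.add_apply]; split_ifs <;> norm_num) (fun h ↦ by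
    have := congrFun h i
    simp only [cubeVec, Pi.add_apply, hi, if_true, Pi.zero_apply] at this
    split_ifs at this
    · norm_num [h2] at this
    · norm_num at this)
  rw [smul_add, two_nsmul_cubeVec_one c, two_nsmul,
    show v - cubeVec 1 b + (cubeVec 1 b + cubeVec 1 c) = v + cubeVec 1 c by abel,
    show v - cubeVec 1 b + (cubeVec 1 b + cubeVec 1 b + cubeVec 2 c) =
      v + cubeVec 2 c + cubeVec 1 b by abel] at this
  unfold ind
  split_ifs <;> simp_all

lemma expect_ite_eq_false : 𝔼 b : ι → Bool, (if b = fun _ ↦ false then (1 : ℝ) else 0) =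
    (1 / 2) ^ Fintype.card ι := by
  rw [Fintype.expect_eq_sum_div_card]
  simp

lemma RestrictedAPFree.boxForm_ge [Fact p.Prime] (hp2 : p ≠ 2)
    {A : Finset (ι → ZMod p)} (hA : RestrictedAPFree A) {δ : ℝ} (hδ : 𝔼 x, ind A x = δ)
    (hδ0 : 0 < δ) (hn : (1 / 2) ^ Fintype.card ι ≤ δ ^ 3 / 2) :
    δ ^ 12 / 256 ≤ boxForm (cubeVec 1) (cubeVec 1) (fun x ↦ ind A x - δ) ∨
      δ ^ 12 / 256 ≤ boxForm (cubeVec 1) (cubeVec 2) (fun x ↦ ind A x - δ) := by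
  have hδ1 : δ ≤ 1 := hδ ▸ expect_ind_le_one A
  set f : (ι → ZMod p) → ℝ := fun x ↦ ind A x - δ with hf
  set T := 𝔼 v, 𝔼 c, 𝔼 b, ind A (v + cubeVec 1 c) *
    (ind A (v - cubeVec 1 b) * ind A (v + cubeVec 2 c + cubeVec 1 b)) with hT
  set T3 := 𝔼 v, 𝔼 c, 𝔼 b, ind A (v + cubeVec 1 c) *
    (ind A (v - cubeVec 1 b) * f (v + cubeVec 2 c + cubeVec 1 b)) with hT3
  set P := 𝔼 v, 𝔼 c, 𝔼 b, ind A v * (1 * f (v + cubeVec 1 c + cubeVec 1 b)) with hP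
  have hTle : T ≤ δ ^ 3 / 2 := by
    refine le_trans ?_ hn
    refine expect_le univ_nonempty fun v _ ↦ expect_le univ_nonempty fun c _ ↦ ?_
    rw [← expect_ite_eq_false]
    exact expect_le_expect fun b _ ↦ hA.ind_mul_le hp2 v b c
  have hQ : 𝔼 v, 𝔼 c, 𝔼 b, ind A (v + cubeVec 1 c) * ind A (v - cubeVec 1 b) =
      P + δ ^ 2 := by
    have h1 : 𝔼 v, 𝔼 c, 𝔼 b, ind A (v + cubeVec 1 c) * ind A (v - cubeVec 1 b) =
        𝔼 v, 𝔼 c, 𝔼 b, ind A v * ind A (v + cubeVec 1 c + cubeVec 1 b) := by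
      refine (expect_rotate _).symm.trans (Eq.trans ?_ (expect_rotate _))
      refine expect_congr rfl fun c _ ↦ expect_congr rfl fun b _ ↦ ?_
      refine Fintype.expect_equiv (Equiv.subRight (cubeVec 1 b)) _ _ fun v ↦ ?_
      rw [Equiv.subRight_apply, mul_comm]
      congr 2
      abel
    rw [h1, hP]
    have h2 (v c b) : ind A v * ind A (v + cubeVec 1 c + cubeVec 1 b) =
        ind A v * (1 * f (v + cubeVec 1 c + cubeVec 1 b)) + ind A v * δ := by
      simp only [hf]; ring
    simp_rw [h2, expect_add_distrib, Fintype.expect_const, ← expect_mul]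
    rw [hδ, sq]
  have hexp : T = T3 + δ * P + δ ^ 3 := by
    have h2 (v c b) : ind A (v + cubeVec 1 c) *
        (ind A (v - cubeVec 1 b) * ind A (v + cubeVec 2 c + cubeVec 1 b)) =
        ind A (v + cubeVec 1 c) * (ind A (v - cubeVec 1 b) * f (v + cubeVec 2 c + cubeVec 1 b)) +
          ind A (v + cubeVec 1 c) * ind A (v - cubeVec 1 b) * δ := by
      simp only [hf]; ring
    simp_rw [hT, h2, expect_add_distrib, ← expect_mul]
    rw [hQ]; ring
  have hpow {x : ℝ} (hx : δ ^ 3 / 4 ≤ |x|) : δ ^ 12 / 256 ≤ x ^ 4 := by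
    have := pow_le_pow_left₀ (by positivity) hx 4
    rw [Even.pow_abs (by decide)] at this
    exact (le_of_eq (by ring)).trans this
  rcases le_total (δ ^ 3 / 4) |P| with h | h
  · exact Or.inl <| (hpow h).trans <| expect_pow_four_le_boxForm _ _ f
      (fun v _ ↦ abs_ind_le_one A v) (fun _ _ ↦ by simp)
  · refine Or.inr <| (hpow (x := T3) ?_).trans <| expect_pow_four_le_boxForm _ _ f
      (fun v _ ↦ abs_ind_le_one A _) (fun _ _ ↦ abs_ind_le_one A _)
    have h3 : δ * -P ≤ 1 * (δ ^ 3 / 4) :=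
      mul_le_mul_of_nonneg hδ1 ((neg_le_abs P).trans h) hδ0.le (by positivity)
    linarith [neg_le_abs T3]
omit [Fintype ι] [DecidableEq ι] [NeZero p] in
lemma RestrictedAPFree.comap_spreadVec [DecidableEq (ι → ZMod p)] {μ κ : Type*}
    [Fintype (μ → ZMod p)] [Nonempty κ] {e : μ × κ → ι} (he : Function.Injective e)
    {A : Finset (ι → ZMod p)} (hA : RestrictedAPFree A) (x : ι → ZMod p) :
    RestrictedAPFree {y | x + spreadVec e y ∈ A} := by
  intro y a ha ha0 ⟨h0, h1, h2⟩
  rw [mem_filter_univ] at h0 h1 h2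
  rw [spreadVec_add he] at h1
  rw [spreadVec_add he, two_nsmul, spreadVec_add he, ← two_nsmul] at h2
  refine hA _ (spreadVec e a) (fun i ↦ ?_) (fun h ↦ ha0 <| funext fun j ↦ ?_)
    ⟨h0, by rwa [add_assoc], by rwa [add_assoc]⟩
  · by_cases hi : ∃ jk, e jk = i
    · obtain ⟨jk, rfl⟩ := hi
      rw [spreadVec_apply he]
      exact ha _
    · exact Or.inl (spreadVec_apply_of_notMem _ hi)
  · have := congrFun h (e (j, Classical.arbitrary κ))
    rwa [spreadVec_apply he] at this

end Counting

lemma exists_density_increment (p : ℕ) [Fact p.Prime] (hp2 : p ≠ 2) :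
    ∃ D : ℕ, 0 < D ∧ ∀ (n m : ℕ) (A : Finset (Fin n → ZMod p)) (δ : ℝ), RestrictedAPFree A →
      D * m ≤ n → 0 < δ → δ ≤ 𝔼 x, ind A x → (1 / 2) ^ m < δ ^ 12 / 1024 →
      ∃ B : Finset (Fin m → ZMod p), RestrictedAPFree B ∧
        𝔼 x, ind A x + δ ^ 12 / 2048 ≤ 𝔼 x, ind B x := by
  have hp0 : 0 < p := (Fact.out : p.Prime).pos
  obtain ⟨K, hK, hbox⟩ := exists_boxForm_maskVec p
  refine ⟨K * (K * (p * p)), by positivity, fun n m A δ' hA hn hδ' hle hm ↦ ?_⟩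
  obtain ⟨δ, hδ⟩ : ∃ δ, 𝔼 x, ind A x = δ := ⟨_, rfl⟩
  rw [hδ] at hle ⊢
  have hδ0 : 0 < δ := hδ'.trans_le hle
  have hδ1 : δ ≤ 1 := hδ ▸ expect_ind_le_one A
  have hpow : δ' ^ 12 ≤ δ ^ 12 := pow_le_pow_left₀ hδ'.le hle 12
  have hmn : m ≤ n := (Nat.le_mul_of_pos_left m (by positivity)).trans hn
  have hanti {k : ℕ} (h : m ≤ k) : (1 / 2 : ℝ) ^ k ≤ (1 / 2) ^ m :=
    pow_le_pow_of_le_one (by norm_num) (by norm_num) h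
  set f : (Fin n → ZMod p) → ℝ := fun x ↦ ind A x - δ with hf
  have hf1 (x) : |f x| ≤ 1 := by
    rw [abs_le, hf]
    constructor <;> linarith [ind_nonneg A x, ind_le_one A x]
  have hf0 : 𝔼 x, f x = 0 := by
    rw [hf, expect_sub_distrib, hδ, Fintype.expect_const, sub_self]
  have h2 : (2 : ZMod p) ≠ 0 := Ring.two_ne_zero (by rwa [ZMod.ringChar_zmod_n])
  have hge := hA.boxForm_ge hp2 hδ hδ0 <| by
    rw [Fintype.card_fin]
    have : δ ^ 12 ≤ δ ^ 3 := pow_le_pow_of_le_one hδ0.le hδ1 (by norm_num)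
    have : 0 < δ ^ 3 := by positivity
    linarith [hanti hmn]
  have hex {γ : ZMod p} (hγ : γ ≠ 0) (h : δ ^ 12 / 256 ≤ boxForm (cubeVec 1) (cubeVec γ) f) :=
    hbox (Fin n) (p * (p * m)) (δ ^ 12 / 256) 1 γ f one_ne_zero hγ hf1
      (by rw [Fintype.card_fin]; exact (le_of_eq (by ring)).trans hn)
      (by
        have : m ≤ p * (p * m) :=
          (Nat.le_mul_of_pos_left m hp0).trans (Nat.le_mul_of_pos_left _ hp0)
        linarith [hanti this]) h
  obtain ⟨U, hU, hUf⟩ := hge.elim (hex one_ne_zero) (hex h2)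
  obtain ⟨x, e, he, hxe⟩ := exists_spreadVec_increment hf1 hf0 U hU (by positivity) hUf
  refine ⟨_, hA.comap_spreadVec he x, ?_⟩
  have : 𝔼 y, f (x + spreadVec e y) =
      𝔼 y, ind ({y | x + spreadVec e y ∈ A} : Finset (Fin m → ZMod p)) y - δ := by
    rw [hf, expect_sub_distrib, Fintype.expect_const]
    simp [ind]
  linarith

lemma expect_ind_add_mul_le_one {p : ℕ} [NeZero p] {D m : ℕ} {δ κ : ℝ} (hD0 : 0 < D)
    (hD : ∀ (n m' : ℕ) (A : Finset (Fin n → ZMod p)), RestrictedAPFree A → D * m' ≤ n →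
      m ≤ m' → δ ≤ 𝔼 x, ind A x → ∃ B : Finset (Fin m' → ZMod p), RestrictedAPFree B ∧
        𝔼 x, ind A x + κ ≤ 𝔼 x, ind B x) (hκ : 0 ≤ κ) (k : ℕ) :
    ∀ (n : ℕ) (A : Finset (Fin n → ZMod p)), RestrictedAPFree A → D ^ k * m ≤ n →
      δ ≤ 𝔼 x, ind A x → 𝔼 x, ind A x + k * κ ≤ 1 := by
  induction k with
  | zero => exact fun n A _ _ _ ↦ by simpa using expect_ind_le_one A
  | succ k ih =>
    intro n A hA hn hδ
    obtain ⟨B, hB, hAB⟩ := hD n (D ^ k * m) A hA ((le_of_eq (by ring)).trans hn)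
      (Nat.le_mul_of_pos_left m (by positivity)) hδ
    have := ih _ B hB le_rfl (by linarith)
    push_cast
    linarith

lemma RestrictedAPFree.exists_mul_log_le_of_ne_two (p : ℕ) [Fact p.Prime] (hp2 : p ≠ 2) :
    ∃ C : ℝ, 0 < C ∧ ∀ (n : ℕ) (A : Finset (Fin n → ZMod p)), RestrictedAPFree A →
      (𝔼 x, ind A x) ^ 12 * Real.log n ≤ C := by
  obtain ⟨D, hD0, hD⟩ := exists_density_increment p hp2
  have hD1 : (1 : ℝ) ≤ D := by exact_mod_cast hD0
  have hlog : 0 < Real.log (2 * D) := Real.log_pos (by linarith)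
  refine ⟨4096 * Real.log (2 * D), by positivity, fun n A hA ↦ ?_⟩
  obtain ⟨δ, hδ⟩ : ∃ δ, 𝔼 x, ind A x = δ := ⟨_, rfl⟩
  rw [hδ]
  have hδ1 : δ ≤ 1 := hδ ▸ expect_ind_le_one A
  rcases (hδ ▸ expect_ind_nonneg A : 0 ≤ δ).eq_or_lt with rfl | hδ0
  · rw [zero_pow (by norm_num), zero_mul]
    positivity
  obtain ⟨κ, hκ⟩ : ∃ κ, δ ^ 12 / 2048 = κ := ⟨_, rfl⟩
  have hκ0 : 0 < κ := by rw [← hκ]; positivity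
  have hκ1 : κ ≤ 1 := by
    have : δ ^ 12 ≤ 1 := pow_le_one₀ hδ0.le hδ1
    linarith
  set N := ⌊1 / κ⌋₊ + 1 with hN
  have hNgt : 1 / κ < N := by rw [hN]; exact_mod_cast Nat.lt_floor_add_one (1 / κ)
  have hNle : N ≤ 1 / κ + 1 := by
    rw [hN]; push_cast; gcongr; exact Nat.floor_le (by positivity)
  have hN2 : (N : ℝ) < 2 ^ N := by exact_mod_cast Nat.lt_two_pow_self
  have hsmall : (1 / 2 : ℝ) ^ N < κ := by
    rw [one_div_pow]
    exact (one_div_lt hκ0 (by positivity)).mp (hNgt.trans hN2)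
  have hlt : n < D ^ N * N := by
    by_contra! hle
    have := expect_ind_add_mul_le_one (m := N) (δ := δ) (κ := κ) hD0
      (fun n m' A hA hn hm hAδ ↦ hκ ▸ hD n m' A δ hA hn hδ0 hAδ (by
        have : (1 / 2 : ℝ) ^ m' ≤ (1 / 2) ^ N :=
          pow_le_pow_of_le_one (by norm_num) (by norm_num) hm
        linarith)) hκ0.le N n A hA hle hδ.ge
    rw [div_lt_iff₀ hκ0] at hNgt
    linarith
  have hlogn : Real.log n ≤ N * Real.log (2 * D) := by
    rcases n.eq_zero_or_pos with rfl | hn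
    · rw [Nat.cast_zero, Real.log_zero]
      positivity
    rw [← Real.log_pow]
    refine Real.log_le_log (by exact_mod_cast hn) ?_
    have : (n : ℝ) ≤ D ^ N * N := by exact_mod_cast hlt.le
    rw [mul_pow, mul_comm]
    exact this.trans (by gcongr)
  have hκN : κ * N ≤ 2 := by
    calc κ * N ≤ κ * (1 / κ + 1) := by gcongr
      _ = 1 + κ := by field_simp
      _ ≤ 2 := by linarith
  calc δ ^ 12 * Real.log n = 2048 * (κ * Real.log n) := by rw [← hκ]; ring
    _ ≤ 2048 * (κ * (N * Real.log (2 * D))) := by gcongr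
    _ = 2048 * (κ * N) * Real.log (2 * D) := by ring
    _ ≤ 2048 * 2 * Real.log (2 * D) := by gcongr
    _ = _ := by ring

lemma RestrictedAPFree.card_le_one {ι : Type*} {A : Finset (ι → ZMod 2)}
    (hA : RestrictedAPFree A) : #A ≤ 1 := by
  refine Finset.card_le_one.mpr fun x hx y hy ↦ ?_
  by_contra hxy
  refine hA x (y - x) (fun i ↦ ?_) (sub_ne_zero.mpr (Ne.symm hxy)) ⟨hx, by simpa using hy, ?_⟩
  · generalize (y - x) i = z
    revert z
    decide
  · have : 2 • (y - x) = 0 := by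
      ext i
      rw [Pi.smul_apply, Pi.zero_apply]
      generalize (y - x) i = z
      revert z
      decide
    rwa [this, add_zero]

lemma expect_ind {α : Type*} [Fintype α] [DecidableEq α] (A : Finset α) :
    𝔼 x, ind A x = #A / Fintype.card α := by
  rw [Fintype.expect_eq_sum_div_card]
  simp [ind]

lemma RestrictedAPFree.exists_mul_log_le (p : ℕ) [Fact p.Prime] :
    ∃ C : ℝ, 0 < C ∧ ∀ (n : ℕ) (A : Finset (Fin n → ZMod p)), RestrictedAPFree A →
      (𝔼 x, ind A x) ^ 12 * Real.log n ≤ C := by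
  rcases ne_or_eq p 2 with hp2 | rfl
  · exact exists_mul_log_le_of_ne_two p hp2
  refine ⟨1, one_pos, fun n A hA ↦ ?_⟩
  have h0 := expect_ind_nonneg A
  have hle : 𝔼 x, ind A x ≤ 1 / 2 ^ n := by
    rw [expect_ind]
    have : (#A : ℝ) ≤ 1 := by exact_mod_cast hA.card_le_one
    simp only [Fintype.card_pi, ZMod.card, prod_const, card_univ, Fintype.card_fin]
    push_cast
    gcongr
  have hlog : Real.log n ≤ 2 ^ n :=
    (Real.log_le_self n.cast_nonneg).trans (by exact_mod_cast Nat.lt_two_pow_self.le)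
  calc _ ≤ (𝔼 x, ind A x) * Real.log n := by
        refine mul_le_mul_of_nonneg_right ?_ (Real.log_natCast_nonneg n)
        exact pow_le_of_le_one h0 (expect_ind_le_one A) (by norm_num)
    _ ≤ 1 / 2 ^ n * 2 ^ n := mul_le_mul hle hlog (Real.log_natCast_nonneg n) (by positivity)
    _ = 1 := by field_simp

lemma log_log_log_le (n : ℕ) (h : 0 < Real.log (Real.log (Real.log n))) :
    Real.log (Real.log (Real.log n)) ≤ Real.log n := by
  obtain ⟨L, hL⟩ : ∃ L, Real.log n = L := ⟨_, rfl⟩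
  have hn : 2 ≤ n := by
    by_contra! hn
    interval_cases n <;> simp at h
  have hL2 : 0.6931 < L := by
    have := Real.log_le_log (by norm_num) (by exact_mod_cast hn : (2 : ℝ) ≤ n)
    linarith [Real.log_two_gt_d9]
  rw [hL] at h ⊢
  rcases le_total 0 (Real.log L) with hl | hl
  · exact (Real.log_le_self hl).trans (Real.log_le_self (by linarith))
  · have h1 : Real.log (Real.log L) ≤ -Real.log L := by
      rw [← Real.log_neg_eq_log]
      exact Real.log_le_self (by linarith)
    have h2 : -Real.log L ≤ L⁻¹ - 1 := by
      rw [← Real.log_inv]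
      exact Real.log_le_sub_one_of_pos (by positivity)
    have h3 : L⁻¹ ≤ 0.6931⁻¹ := by gcongr
    norm_num at h3 hL2
    linarith

/-- **Restricted 3-AP free sets in `𝔽_p^n` have density `O(1/(log log log n)^c)`.**
For every prime `p` there are constants `c, C > 0` (depending only on `p`) such that for all
`n` with `log log log n > 0`, every set `A ⊆ 𝔽_p^n` containing no triple `x, x+a, x+2a` with
`a ∈ {0,1,2}^n \ {0}` satisfies `|A|/p^n ≤ C / (log log log n)^c`. -/
theorem restricted_threeAP_free_density_bound (p : ℕ) (hp : p.Prime) [NeZero p] :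
    ∃ c C : ℝ, 0 < c ∧ 0 < C ∧
      ∀ n : ℕ, 0 < Real.log (Real.log (Real.log n)) →
        ∀ A : Finset (Fin n → ZMod p),
          (∀ x a : Fin n → ZMod p, (∀ i, a i = 0 ∨ a i = 1 ∨ a i = 2) → a ≠ 0 →
              ¬(x ∈ A ∧ x + a ∈ A ∧ x + 2 • a ∈ A)) →
          (A.card : ℝ) / (p : ℝ) ^ n ≤ C / Real.log (Real.log (Real.log n)) ^ c := by
  have : Fact p.Prime := ⟨hp⟩
  obtain ⟨C, hC, h⟩ := RestrictedAPFree.exists_mul_log_le p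
  refine ⟨1 / 12, C ^ (1 / 12 : ℝ), by norm_num, by positivity, fun n hn A hA ↦ ?_⟩
  have hδ := h n A hA
  have hδ0 := expect_ind_nonneg A
  rw [expect_ind] at hδ hδ0
  simp only [Fintype.card_pi, ZMod.card, Finset.prod_const, Finset.card_univ, Fintype.card_fin,
    Nat.cast_pow] at hδ hδ0
  set δ : ℝ := #A / (p : ℝ) ^ n
  set x := Real.log (Real.log (Real.log n))
  calc δ = (δ ^ 12) ^ (1 / 12 : ℝ) := by
        rw [← Real.rpow_natCast, ← Real.rpow_mul hδ0]; norm_num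
    _ ≤ (C / x) ^ (1 / 12 : ℝ) := by
        gcongr
        rw [le_div_iff₀ hn]
        exact le_trans (by gcongr; exact log_log_log_le n hn) hδ
    _ = C ^ (1 / 12 : ℝ) / x ^ (1 / 12 : ℝ) := Real.div_rpow hC.le hn.le _
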